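/- arXiv:2210.08625 — 3 statements merged into one kernel-verified Lean document; each statement's English description precedes it below -/
import Mathlib

section
/- Let Δ_M ⊆ Δ be a subset and let α ∈ Δ \ Δ_M be a simple root not in Δ_M. Then the M-average av_M(α^∨) of the coroot α^∨ is a ℚ_{≥0}-linear combination of positive coroots. -/
open scoped BigOperators Classical

/-- A finite crystallographic reduced root system `Φ` (with coroots) in a ℚ-vector space `V`,
together with a fixed base `Δ` of simple roots. -/
structure RootSystemData (V V' : Type) [AddCommGroup V] [Module ℚ V]
    [AddCommGroup V'] [Module ℚ V'] where
  /-- the canonical pairing `⟨·,·⟩ : V × V^∨ → ℚ` -/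
  pair : V →ₗ[ℚ] V' →ₗ[ℚ] ℚ
  /-- the finite set of roots `Φ ⊆ V` -/
  roots : Finset V
  /-- the coroot `α^∨ ∈ V^∨` attached to a root `α` -/
  coroot : V → V'
  /-- the base `Δ ⊆ Φ` of simple roots -/
  base : Finset V
  base_subset : base ⊆ roots
  pair_self : ∀ α ∈ roots, pair α (coroot α) = 2
  root_reflect : ∀ α ∈ roots, ∀ β ∈ roots, β - pair β (coroot α) • α ∈ roots
  coroot_reflect : ∀ α ∈ roots, ∀ β ∈ roots,
      coroot β - pair α (coroot β) • coroot α = coroot (β - pair β (coroot α) • α)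
  crystallographic : ∀ α ∈ roots, ∀ β ∈ roots, ∃ n : ℤ, pair β (coroot α) = n
  reduced : ∀ α ∈ roots, ∀ t : ℚ, t • α ∈ roots → t = 1 ∨ t = -1
  base_indep : LinearIndependent ℚ (fun a : base => (a : V))
  root_pos_or_neg : ∀ β ∈ roots,
      (∃ c : V → ℚ, (∀ α, 0 ≤ c α) ∧ β = ∑ α ∈ base, c α • α) ∨
      (∃ c : V → ℚ, (∀ α, 0 ≤ c α) ∧ -β = ∑ α ∈ base, c α • α)

namespace RootSystemData

variable {V V' : Type} [AddCommGroup V] [Module ℚ V] [AddCommGroup V'] [Module ℚ V']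
variable (P : RootSystemData V V')

/-- The pair of reflections `(s_α on V, s_α on V^∨)` attached to a root `α`. -/
noncomputable def reflPair (α : V) (hα : α ∈ P.roots) :
    (V ≃ₗ[ℚ] V) × (V' ≃ₗ[ℚ] V') :=
  (Module.reflection (f := P.pair.flip (P.coroot α)) (x := α) (P.pair_self α hα),
   Module.reflection (f := P.pair α) (x := P.coroot α) (P.pair_self α hα))

/-- The subgroup `W_M` generated by the reflections `s_α` for `α ∈ Δ_M`, acting
compatibly on `V` and `V^∨`. -/
noncomputable def weyl (ΔM : Finset V) : Subgroup ((V ≃ₗ[ℚ] V) × (V' ≃ₗ[ℚ] V')) :=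
  Subgroup.closure { g | ∃ (α : V) (hα : α ∈ P.roots), α ∈ ΔM ∧ g = P.reflPair α hα }

/-- The `M`-average `av_M(ν) = (1/|W_M|) ∑_{w ∈ W_M} w·ν` of `ν ∈ V^∨`. -/
noncomputable def avg (ΔM : Finset V) (ν : V') : V' :=
  (Nat.card (P.weyl ΔM) : ℚ)⁻¹ •
    ∑ᶠ w : P.weyl ΔM, ((w : (V ≃ₗ[ℚ] V) × (V' ≃ₗ[ℚ] V')).2 ν)

/-- The set `Φ^+` of positive roots with respect to the base `Δ`. -/
noncomputable def posRoots : Finset V :=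
  P.roots.filter fun β => ∃ c : V → ℚ, (∀ α, 0 ≤ c α) ∧ β = ∑ α ∈ P.base, c α • α

/-- `ρ_G`, the half sum of the positive roots. -/
noncomputable def rho : V := (2 : ℚ)⁻¹ • ∑ α ∈ P.posRoots, α

/-- `ρ_M`, the half sum of the positive roots lying in the span of `Δ_M`. -/
noncomputable def rhoLevi (ΔM : Finset V) : V :=
  (2 : ℚ)⁻¹ • ∑ α ∈ P.posRoots.filter
      (fun β => β ∈ Submodule.span ℚ (ΔM : Set V)), α

/-- `ν ∈ V^∨` is central if `⟨α, ν⟩ = 0` for all `α ∈ Φ`. -/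
def IsCentral (ν : V') : Prop := ∀ α ∈ P.roots, P.pair α ν = 0

/-- `ν ∈ V^∨` is non-negative if `ν = z + ∑_{α ∈ Δ} c_α • α^∨` with `z` central and
all `c_α ≥ 0`. -/
def IsNonneg (ν : V') : Prop :=
  ∃ (z : V') (c : V → ℚ), P.IsCentral z ∧ (∀ α, 0 ≤ c α) ∧
    ν = z + ∑ α ∈ P.base, c α • P.coroot α

end RootSystemData

namespace RootSystemData

section Averages

variable {V V' : Type} [AddCommGroup V] [Module ℚ V] [AddCommGroup V'] [Module ℚ V']
variable (P : RootSystemData V V')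

/-- The cone of nonnegative combinations of positive coroots. -/
def IsPosCorootComb (ν : V') : Prop :=
  ∃ c : V' → ℚ, (∀ x, 0 ≤ c x) ∧ ν = ∑ x ∈ P.posRoots.image P.coroot, c x • x

variable {P}

lemma IsPosCorootComb.zero : P.IsPosCorootComb 0 := ⟨0, by simp, by simp⟩

lemma IsPosCorootComb.add {μ ν : V'} (hμ : P.IsPosCorootComb μ) (hν : P.IsPosCorootComb ν) :
    P.IsPosCorootComb (μ + ν) := by
  obtain ⟨c, hc, rfl⟩ := hμ
  obtain ⟨d, hd, rfl⟩ := hν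
  exact ⟨c + d, fun x => add_nonneg (hc x) (hd x), by
    simp [add_smul, Finset.sum_add_distrib]⟩

lemma IsPosCorootComb.smul {ν : V'} {t : ℚ} (ht : 0 ≤ t) (hν : P.IsPosCorootComb ν) :
    P.IsPosCorootComb (t • ν) := by
  obtain ⟨c, hc, rfl⟩ := hν
  exact ⟨fun x => t * c x, fun x => mul_nonneg ht (hc x), by
    simp [mul_smul, Finset.smul_sum]⟩

lemma IsPosCorootComb.coroot {β : V} (hβ : β ∈ P.posRoots) :
    P.IsPosCorootComb (P.coroot β) := by
  refine ⟨fun x => if x = P.coroot β then 1 else 0, fun x => by dsimp only; split_ifs <;> norm_num, ?_⟩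
  simp only [ite_smul, one_smul, zero_smul]
  rw [Finset.sum_ite_eq', if_pos (Finset.mem_image_of_mem _ hβ)]

variable (P)

lemma reflPair_fst_apply (α : V) (hα : α ∈ P.roots) (v : V) :
    (P.reflPair α hα).1 v = v - P.pair v (P.coroot α) • α :=
  Module.reflection_apply v (P.pair_self α hα)

lemma reflPair_snd_apply (α : V) (hα : α ∈ P.roots) (ν : V') :
    (P.reflPair α hα).2 ν = ν - P.pair α ν • P.coroot α :=
  Module.reflection_apply ν (P.pair_self α hα)

lemma reflPair_inv (α : V) (hα : α ∈ P.roots) :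
    (P.reflPair α hα)⁻¹ = P.reflPair α hα := by
  refine inv_eq_of_mul_eq_one_left (Prod.ext ?_ ?_)
  · exact LinearEquiv.ext (Module.involutive_reflection (f := P.pair.flip (P.coroot α))
      (P.pair_self α hα))
  · exact LinearEquiv.ext (Module.involutive_reflection (f := P.pair α) (P.pair_self α hα))

/-- Elements of `W_M` permute the roots compatibly with the coroots, and move each root by an
element of the span of `Δ_M`. -/
lemma weyl_apply_root {ΔM : Finset V} {w : (V ≃ₗ[ℚ] V) × (V' ≃ₗ[ℚ] V')}
    (hw : w ∈ P.weyl ΔM) {β : V} (hβ : β ∈ P.roots) :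
    w.1 β ∈ P.roots ∧ w.2 (P.coroot β) = P.coroot (w.1 β) ∧
      w.1 β - β ∈ Submodule.span ℚ (ΔM : Set V) := by
  have key : ∀ g : (V ≃ₗ[ℚ] V) × (V' ≃ₗ[ℚ] V'),
      ∀ (α : V) (hα : α ∈ P.roots), α ∈ ΔM →
      (g.1 β ∈ P.roots ∧ g.2 (P.coroot β) = P.coroot (g.1 β) ∧
        g.1 β - β ∈ Submodule.span ℚ (ΔM : Set V)) →
      ((P.reflPair α hα * g).1 β ∈ P.roots ∧
        (P.reflPair α hα * g).2 (P.coroot β) = P.coroot ((P.reflPair α hα * g).1 β) ∧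
        (P.reflPair α hα * g).1 β - β ∈ Submodule.span ℚ (ΔM : Set V)) := by
    rintro g α hα hαM ⟨h₁, h₂, h₃⟩
    simp only [Prod.fst_mul, Prod.snd_mul, LinearEquiv.mul_apply, h₂, reflPair_fst_apply,
      reflPair_snd_apply]
    refine ⟨P.root_reflect α hα _ h₁, P.coroot_reflect α hα _ h₁, ?_⟩
    rw [sub_right_comm]
    exact sub_mem h₃ (Submodule.smul_mem _ _ (Submodule.subset_span hαM))
  induction hw using Subgroup.closure_induction_left with
  | one => simpa using hβ
  | mul_left x hx y _ ih =>
    obtain ⟨α, hα, hαM, rfl⟩ := hx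
    exact key y α hα hαM ih
  | inv_mul_cancel x hx y _ ih =>
    obtain ⟨α, hα, hαM, rfl⟩ := hx
    rw [reflPair_inv]
    exact key y α hα hαM ih

/-- A root congruent to a simple root `α` modulo the span of simple roots other than `α` is
positive. -/
lemma mem_posRoots_of_sub_mem_span {ΔM : Finset V} (hM : ΔM ⊆ P.base) {α β : V}
    (hα : α ∈ P.base) (hαM : α ∉ ΔM) (hβ : β ∈ P.roots)
    (h : β - α ∈ Submodule.span ℚ (ΔM : Set V)) : β ∈ P.posRoots := by
  refine Finset.mem_filter.mpr ⟨hβ, (P.root_pos_or_neg β hβ).resolve_right ?_⟩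
  rintro ⟨c, hc, hcβ⟩
  have hind : LinearIndepOn ℚ id (P.base : Set V) := P.base_indep
  have hα_span : α ∉ Submodule.span ℚ ((P.base : Set V) \ {α}) := by
    simpa using hind.notMem_span hα
  obtain ⟨f, hfα, hf⟩ := Submodule.exists_le_ker_of_notMem hα_span
  have hf₀ : ∀ γ ∈ P.base, γ ≠ α → f γ = 0 := fun γ hγ hne =>
    hf (Submodule.subset_span ⟨hγ, hne⟩)
  have hfβ : f β = f α := by
    rw [← sub_eq_zero, ← map_sub]
    exact hf (Submodule.span_mono (Set.subset_sdiff_singleton (Finset.coe_subset.mpr hM) hαM) h)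
  have hsum : f (-β) = c α * f α := by
    rw [hcβ, map_sum, Finset.sum_eq_single_of_mem α hα fun γ hγ hne => by
      simp [hf₀ γ hγ hne]]
    simp
  rw [map_neg, hfβ] at hsum
  have : (1 + c α) * f α = 0 := by linarith
  rcases mul_eq_zero.mp this with h | h
  · linarith [hc α]
  · exact hfα h

end Averages

variable {V V' : Type} [AddCommGroup V] [Module ℚ V] [AddCommGroup V'] [Module ℚ V']
variable [FiniteDimensional ℚ V] [FiniteDimensional ℚ V']
variable (P : RootSystemData V V')

/-- if `Δ_M ⊆ Δ` and `α ∈ Δ \ Δ_M` is a simple root not in `Δ_M`, then the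
`M`-average `av_M(α^∨)` of the coroot `α^∨` is a `ℚ_{≥0}`-linear combination of positive
coroots. -/
theorem avg_coroot_nonneg_comb (ΔM : Finset V) (hM : ΔM ⊆ P.base)
    (α : V) (hα : α ∈ P.base) (hαM : α ∉ ΔM) :
    ∃ c : V' → ℚ, (∀ x, 0 ≤ c x) ∧
      P.avg ΔM (P.coroot α) = ∑ x ∈ P.posRoots.image P.coroot, c x • x := by
  change P.IsPosCorootComb _
  refine IsPosCorootComb.smul (by positivity) ?_
  refine finsum_induction P.IsPosCorootComb .zero (fun _ _ => .add) fun w => ?_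
  obtain ⟨hroot, hcoroot, hspan⟩ := P.weyl_apply_root w.2 (P.base_subset hα)
  rw [hcoroot]
  exact .coroot (P.mem_posRoots_of_sub_mem_span hM hα hαM hroot hspan)

end RootSystemData
end

section
/- For every subset Δ_M ⊆ Δ, the M-averaging map av_M preserves non-negativity: if ν ∈ V^∨ is non-negative, then av_M(ν) is non-negative. -/
open scoped BigOperators Classical

namespace RootSystemData

section Helpers

variable {V V' : Type} [AddCommGroup V] [Module ℚ V] [AddCommGroup V'] [Module ℚ V']
variable (P : RootSystemData V V')

/-- The Weyl-invariant symmetric form `(x, y) ↦ ∑_{γ ∈ Φ} ⟨γ, x⟩ ⟨γ, y⟩` on `V^∨`. -/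
noncomputable def canonicalForm : V' →ₗ[ℚ] V' →ₗ[ℚ] ℚ :=
  ∑ γ ∈ P.roots, LinearMap.smulRightₗ (P.pair γ) (P.pair γ)

theorem canonicalForm_apply (x y : V') :
    P.canonicalForm x y = ∑ γ ∈ P.roots, P.pair γ x * P.pair γ y := by
  simp [canonicalForm, LinearMap.sum_apply]

theorem canonicalForm_self_nonneg (x : V') : 0 ≤ P.canonicalForm x x := by
  rw [canonicalForm_apply]
  exact Finset.sum_nonneg fun γ _ => mul_self_nonneg _

theorem isCentral_of_canonicalForm_self_nonpos {x : V'} (hx : P.canonicalForm x x ≤ 0) :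
    P.IsCentral x := by
  have h := le_antisymm hx (P.canonicalForm_self_nonneg x)
  rw [canonicalForm_apply, Finset.sum_eq_zero_iff_of_nonneg fun γ _ => mul_self_nonneg _] at h
  exact fun α hα => mul_self_eq_zero.mp (h α hα)

/-- The pairing with a root `α` is proportional to the canonical form against `α^∨`. -/
theorem two_mul_canonicalForm_coroot {α : V} (hα : α ∈ P.roots) (y : V') :
    2 * P.canonicalForm (P.coroot α) y =
      P.canonicalForm (P.coroot α) (P.coroot α) * P.pair α y := by
  have hinv (γ : V) : (γ - P.pair γ (P.coroot α) • α) -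
      P.pair (γ - P.pair γ (P.coroot α) • α) (P.coroot α) • α = γ := by
    simp only [map_sub, map_smul, LinearMap.sub_apply, LinearMap.smul_apply, smul_eq_mul,
      P.pair_self α hα]
    module
  have hsum : P.canonicalForm (P.coroot α) y =
      ∑ γ ∈ P.roots, P.pair (γ - P.pair γ (P.coroot α) • α) (P.coroot α) *
        P.pair (γ - P.pair γ (P.coroot α) • α) y := by
    rw [canonicalForm_apply]
    exact (Finset.sum_nbij' (fun γ => γ - P.pair γ (P.coroot α) • α)
      (fun γ => γ - P.pair γ (P.coroot α) • α) (fun γ => P.root_reflect α hα γ)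
      (fun γ => P.root_reflect α hα γ) (fun γ _ => hinv γ) (fun γ _ => hinv γ)
      fun γ _ => rfl).symm
  have hreflect : P.canonicalForm (P.coroot α) y = -P.canonicalForm (P.coroot α) y +
      P.canonicalForm (P.coroot α) (P.coroot α) * P.pair α y := by
    conv_lhs => rw [hsum]
    simp only [canonicalForm_apply, Finset.sum_mul, ← Finset.sum_neg_distrib,
      ← Finset.sum_add_distrib]
    refine Finset.sum_congr rfl fun γ _ => ?_
    simp only [map_sub, map_smul, LinearMap.sub_apply, LinearMap.smul_apply, smul_eq_mul,
      P.pair_self α hα]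
    ring
  linarith

/-- Distinct simple roots form obtuse angles. -/
theorem pair_coroot_nonpos {α β : V} (hα : α ∈ P.base) (hβ : β ∈ P.base) (hne : α ≠ β) :
    P.pair α (P.coroot β) ≤ 0 := by
  have hindep : ∀ f g : V → ℚ, ∑ γ ∈ P.base, f γ • γ = ∑ γ ∈ P.base, g γ • γ →
      ∀ γ ∈ P.base, f γ = g γ := by
    intro f g hfg γ hγ
    refine Fintype.linearIndependent_iffₛ.mp P.base_indep (fun i => f i) (fun i => g i) ?_ ⟨γ, hγ⟩
    rw [Finset.sum_coe_sort P.base fun γ => f γ • γ, Finset.sum_coe_sort P.base fun γ => g γ • γ,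
      hfg]
  have hexp : α - P.pair α (P.coroot β) • β = ∑ γ ∈ P.base,
      ((if γ = α then 1 else 0) - if γ = β then P.pair α (P.coroot β) else 0) • γ := by
    simp [sub_smul, Finset.sum_sub_distrib, ite_smul, hα, hβ]
  rcases P.root_pos_or_neg _ (P.root_reflect β (P.base_subset hβ) α (P.base_subset hα)) with
    ⟨c, hc, h⟩ | ⟨c, hc, h⟩
  · have := hindep _ _ (hexp.symm.trans h) β hβ
    simp only [hne.symm, if_true, if_false] at this
    linarith [hc β]
  · have hneg : ∑ γ ∈ P.base, (-c γ) • γ = α - P.pair α (P.coroot β) • β := by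
      simp only [neg_smul, Finset.sum_neg_distrib, ← h, neg_neg]
    have := hindep _ _ (hneg.trans hexp) α hα
    simp only [hne, if_true, if_false] at this
    linarith [hc α]

theorem canonicalForm_coroot_nonpos {α β : V} (hα : α ∈ P.base) (hβ : β ∈ P.base) (hne : α ≠ β) :
    P.canonicalForm (P.coroot α) (P.coroot β) ≤ 0 := by
  have h := P.two_mul_canonicalForm_coroot (P.base_subset hα) (P.coroot β)
  have := mul_nonpos_of_nonneg_of_nonpos (P.canonicalForm_self_nonneg (P.coroot α))
    (P.pair_coroot_nonpos hα hβ hne)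
  linarith

/-- If `μ` is orthogonal to `Δ_M` and its coefficients outside `Δ_M` are non-negative, then
`μ` is non-negative. -/
theorem isNonneg_of_pair_eq_zero {ΔM : Finset V} {z : V'} {c : V → ℚ} (hz : P.IsCentral z)
    (hc : ∀ α ∉ ΔM, 0 ≤ c α)
    (horth : ∀ γ ∈ ΔM, P.pair γ (z + ∑ α ∈ P.base, c α • P.coroot α) = 0) :
    P.IsNonneg (z + ∑ α ∈ P.base, c α • P.coroot α) := by
  set p : V' := ∑ α ∈ P.base, (c α)⁺ • P.coroot α with hp
  set n : V' := ∑ α ∈ P.base, (c α)⁻ • P.coroot α with hn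
  have hpn : ∑ α ∈ P.base, c α • P.coroot α = p - n := by
    simp only [hp, hn, ← Finset.sum_sub_distrib, ← sub_smul, posPart_sub_negPart]
  rw [hpn] at horth ⊢
  have hn_orth : P.canonicalForm n (z + (p - n)) = 0 := by
    rw [hn, map_sum, LinearMap.sum_apply, ← hn]
    refine Finset.sum_eq_zero fun α hα => ?_
    by_cases hαM : α ∈ ΔM
    · have h := P.two_mul_canonicalForm_coroot (P.base_subset hα) (z + (p - n))
      rw [horth α hαM, mul_zero] at h
      rw [map_smul, LinearMap.smul_apply, (mul_eq_zero.mp h).resolve_left two_ne_zero, smul_zero]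
    · rw [negPart_eq_zero.mpr (hc α hαM), zero_smul, map_zero, LinearMap.zero_apply]
  have hn_z : P.canonicalForm n z = 0 := by
    rw [canonicalForm_apply]
    exact Finset.sum_eq_zero fun γ hγ => by rw [hz γ hγ, mul_zero]
  have hn_p : P.canonicalForm n p ≤ 0 := by
    simp only [hn, hp, map_sum, LinearMap.sum_apply, map_smul, LinearMap.smul_apply, smul_eq_mul,
      Finset.mul_sum]
    refine Finset.sum_nonpos fun α hα => Finset.sum_nonpos fun β hβ => ?_
    rcases eq_or_ne α β with rfl | hne
    · rcases le_total 0 (c α) with h | h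
      · simp [negPart_eq_zero.mpr h]
      · simp [posPart_eq_zero.mpr h]
    · exact mul_nonpos_of_nonneg_of_nonpos (posPart_nonneg _)
        (mul_nonpos_of_nonneg_of_nonpos (negPart_nonneg _)
          (P.canonicalForm_coroot_nonpos hβ hα hne.symm))
  have hn_central : P.IsCentral n := by
    apply P.isCentral_of_canonicalForm_self_nonpos
    rw [map_add, map_sub] at hn_orth
    linarith
  refine ⟨z - n, fun α => (c α)⁺, fun α hα => ?_, fun α => posPart_nonneg _, by abel⟩
  rw [map_sub, hz α hα, hn_central α hα, sub_zero]

theorem weyl_apply_sub_mem_span (ΔM : Finset V) {w : (V ≃ₗ[ℚ] V) × (V' ≃ₗ[ℚ] V')}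
    (hw : w ∈ P.weyl ΔM) (ν : V') :
    w.2 ν - ν ∈ Submodule.span ℚ (P.coroot '' ΔM) := by
  induction hw using Subgroup.closure_induction generalizing ν with
  | mem w hw =>
    obtain ⟨α, hα, hαM, rfl⟩ := hw
    rw [reflPair, Module.reflection_apply, sub_sub_cancel_left]
    exact neg_mem (Submodule.smul_mem _ _ (Submodule.subset_span (Set.mem_image_of_mem _ hαM)))
  | one => simp
  | mul u v _ _ hu hv => simpa using add_mem (hu (v.2 ν)) (hv ν)
  | inv w _ hw =>
    rw [← neg_mem_iff, neg_sub]
    simpa using hw (w⁻¹.2 ν)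

section Finite

variable (ΔM : Finset V) [Finite (P.weyl ΔM)]

theorem avg_sub_mem_span (ν : V') :
    P.avg ΔM ν - ν ∈ Submodule.span ℚ (P.coroot '' ΔM) := by
  have := Fintype.ofFinite (P.weyl ΔM)
  have hcard : (Nat.card (P.weyl ΔM) : ℚ) ≠ 0 := Nat.cast_ne_zero.mpr Nat.card_pos.ne'
  have h : P.avg ΔM ν - ν = (Nat.card (P.weyl ΔM) : ℚ)⁻¹ • ∑ w : P.weyl ΔM, (w.1.2 ν - ν) := by
    rw [avg, finsum_eq_sum_of_fintype, Finset.sum_sub_distrib, smul_sub, Finset.sum_const,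
      Finset.card_univ, ← Nat.card_eq_fintype_card, ← Nat.cast_smul_eq_nsmul ℚ,
      inv_smul_smul₀ hcard]
  rw [h]
  exact Submodule.smul_mem _ _ (Submodule.sum_mem _ fun w _ =>
    P.weyl_apply_sub_mem_span ΔM w.2 ν)

theorem weyl_apply_avg (w : P.weyl ΔM) (ν : V') : w.1.2 (P.avg ΔM ν) = P.avg ΔM ν := by
  have := Fintype.ofFinite (P.weyl ΔM)
  rw [avg, map_smul, finsum_eq_sum_of_fintype, map_sum]
  congr 1
  exact Fintype.sum_equiv (Equiv.mulLeft w) _ _ fun _ => rfl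

theorem pair_avg {γ : V} (hγ : γ ∈ P.roots) (hγM : γ ∈ ΔM) (ν : V') :
    P.pair γ (P.avg ΔM ν) = 0 := by
  have h := congrArg (P.pair γ) (P.weyl_apply_avg ΔM
    ⟨P.reflPair γ hγ, Subgroup.subset_closure ⟨γ, hγ, hγM, rfl⟩⟩ ν)
  simp only [reflPair, Module.reflection_apply, map_sub, map_smul, smul_eq_mul,
    P.pair_self γ hγ] at h
  linarith

end Finite

end Helpers

end RootSystemData

namespace RootSystemData

variable {V V' : Type} [AddCommGroup V] [Module ℚ V] [AddCommGroup V'] [Module ℚ V']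
variable [FiniteDimensional ℚ V] [FiniteDimensional ℚ V']
variable (P : RootSystemData V V')

/-- for every `Δ_M ⊆ Δ`, the `M`-averaging map `av_M` preserves non-negativity:
if `ν ∈ V^∨` is non-negative, then `av_M(ν)` is non-negative. -/
theorem avg_preserves_nonneg (ΔM : Finset V) (hM : ΔM ⊆ P.base) (ν : V')
    (hν : P.IsNonneg ν) : P.IsNonneg (P.avg ΔM ν) := by
  obtain ⟨z, c, hz, hc, rfl⟩ := hν
  set ν : V' := z + ∑ α ∈ P.base, c α • P.coroot α with hν
  rcases finite_or_infinite (P.weyl ΔM) with hfin | hinf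
  · obtain ⟨d, hdM, hd⟩ := (Finsupp.mem_span_image_iff_linearCombination ℚ).mp
      (P.avg_sub_mem_span ΔM ν)
    rw [Finsupp.linearCombination_apply_of_mem_supported ℚ hdM] at hd
    have hexp : P.avg ΔM ν =
        z + ∑ α ∈ P.base, (c α + if α ∈ ΔM then d α else 0) • P.coroot α := by
      rw [← sub_add_cancel (P.avg ΔM ν) ν, ← hd, hν]
      simp only [add_smul, Finset.sum_add_distrib, ite_smul, zero_smul, Finset.sum_ite_mem,
        Finset.inter_eq_right.mpr hM]
      abel
    have horth (γ : V) (hγ : γ ∈ ΔM) := P.pair_avg ΔM (P.base_subset (hM hγ)) hγ ν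
    rw [hexp] at horth ⊢
    exact P.isNonneg_of_pair_eq_zero hz (fun α hα => by simpa [hα] using hc α) horth
  · rw [avg, Nat.card_eq_zero_of_infinite, Nat.cast_zero, inv_zero, zero_smul]
    exact ⟨0, 0, fun α _ => map_zero _, fun _ => le_rfl, by simp⟩

end RootSystemData
end

section
/- Block-averaging preserves polygonal non-negativity: let n ≥ 1 and let x : {1,…,n} → ℚ satisfy Σ_{i≤k} x_i ≥ (k/n)·Σ_{i≤n} x_i for every 1 ≤ k ≤ n. Let {1,…,n} be partitioned into consecutive blocks B_1, …, B_r (corresponding to a partition of n), and define y : {1,…,n} → ℚ by letting y_i be the average (1/|B_j|)·Σ_{i'∈B_j} x_{i'} of the block B_j containing i. Then Σ_{i≤k} y_i ≥ (k/n)·Σ_{i≤n} y_i for every 1 ≤ k ≤ n, and Σ_{i≤n} y_i = Σ_{i≤n} x_i. -/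
open scoped BigOperators

/-- On an interval where `y` is constant, its partial sums are affine. -/
theorem sum_range_eq_add_of_const {y : ℕ → ℚ} {l k : ℕ} {m : ℚ} (hlk : l ≤ k)
    (hy : ∀ i, l ≤ i → i < k → y i = m) :
    ∑ i ∈ Finset.range k, y i = ∑ i ∈ Finset.range l, y i + ((k : ℚ) - l) * m := by
  rw [← Finset.sum_range_add_sum_Ico y hlk]
  congr 1
  rw [Finset.sum_congr rfl fun i hi => hy i (Finset.mem_Ico.1 hi).1 (Finset.mem_Ico.1 hi).2]
  simp [Nat.cast_sub hlk]

/-- An affine function which dominates `t ↦ c * t` at the endpoints of an interval dominates it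
on the whole interval. -/
theorem mul_le_add_mul_of_endpoints {c l u k p m : ℚ} (hlu : l < u) (hlk : l ≤ k) (hku : k ≤ u)
    (hl : c * l ≤ p) (hu : c * u ≤ p + (u - l) * m) : c * k ≤ p + (k - l) * m := by
  have h₁ := mul_nonneg (sub_nonneg.2 hku) (sub_nonneg.2 hl)
  have h₂ := mul_nonneg (sub_nonneg.2 hlk) (sub_nonneg.2 hu)
  refine le_of_mul_le_mul_left ?_ (sub_pos.2 hlu)
  linarith

/-- Block-averaging along `a 0 < a 1 < ⋯ < a r` does not change the partial sums at the `a j`. -/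
theorem sum_range_block_average {x y : ℕ → ℚ} {r : ℕ} {a : ℕ → ℕ} (ha0 : a 0 = 0)
    (hmono : ∀ j < r, a j < a (j + 1))
    (hy : ∀ j < r, ∀ i : ℕ, a j ≤ i → i < a (j + 1) →
      y i = (((a (j + 1) : ℚ) - (a j : ℚ)))⁻¹ * ∑ i' ∈ Finset.Ico (a j) (a (j + 1)), x i')
    {j : ℕ} (hj : j ≤ r) :
    ∑ i ∈ Finset.range (a j), y i = ∑ i ∈ Finset.range (a j), x i := by
  induction j with
  | zero => simp [ha0]
  | succ j ih =>
    have hlt := hmono j hj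
    have hne : (a (j + 1) : ℚ) - a j ≠ 0 := (sub_pos.2 (Nat.cast_lt.2 hlt)).ne'
    rw [sum_range_eq_add_of_const hlt.le (hy j hj), ih (Nat.le_of_succ_le hj),
      mul_inv_cancel_left₀ hne, Finset.sum_range_add_sum_Ico x hlt.le]

/-- block-averaging preserves polygonal non-negativity (the `GL_n` instance of
the statement that Levi averaging preserves non-negativity of coweights). Here the entries of
`x : ℚ^n` are indexed by `0, …, n-1`, consecutive blocks are cut out by an increasing sequence
`0 = a 0 < a 1 < ⋯ < a r = n`, and `y` replaces each entry of `x` by the average of the entries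
in its block. If the partial sums of `x` satisfy `∑_{i<k} x i ≥ (k/n)·∑_{i<n} x i` for all
`1 ≤ k ≤ n`, then so do those of `y`, and moreover `∑_{i<n} y i = ∑_{i<n} x i`. -/
theorem block_average_preserves_polygonal_nonneg
    (n : ℕ) (hn : 1 ≤ n) (x y : ℕ → ℚ)
    (hx : ∀ k : ℕ, 1 ≤ k → k ≤ n →
      (k / n : ℚ) * ∑ i ∈ Finset.range n, x i ≤ ∑ i ∈ Finset.range k, x i)
    (r : ℕ) (a : ℕ → ℕ) (ha0 : a 0 = 0) (har : a r = n)
    (hmono : ∀ j < r, a j < a (j + 1))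
    (hy : ∀ j < r, ∀ i : ℕ, a j ≤ i → i < a (j + 1) →
      y i = (((a (j + 1) : ℚ) - (a j : ℚ)))⁻¹ * ∑ i' ∈ Finset.Ico (a j) (a (j + 1)), x i') :
    (∀ k : ℕ, 1 ≤ k → k ≤ n →
      (k / n : ℚ) * ∑ i ∈ Finset.range n, y i ≤ ∑ i ∈ Finset.range k, y i) ∧
    ∑ i ∈ Finset.range n, y i = ∑ i ∈ Finset.range n, x i := by
  have hsum {j : ℕ} (hj : j ≤ r) := sum_range_block_average ha0 hmono hy hj
  have htot : ∑ i ∈ Finset.range n, y i = ∑ i ∈ Finset.range n, x i := har ▸ hsum le_rfl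
  refine ⟨?_, htot⟩
  rw [htot]
  set S := ∑ i ∈ Finset.range n, x i
  have hx' {k : ℕ} (hk : k ≤ n) : S / n * k ≤ ∑ i ∈ Finset.range k, x i := by
    rcases k.eq_zero_or_pos with rfl | hk0
    · simp
    · exact (by ring : S / n * k = k / n * S).trans_le (hx k hk0 hk)
  have han {j : ℕ} (hj : j ≤ r) : a j ≤ n := by
    induction hj using Nat.decreasingInduction with
    | self => exact har.le
    | of_succ j hj ih => exact (hmono j hj).le.trans ih
  have hy' {j : ℕ} (hj : j ≤ r) : S / n * a j ≤ ∑ i ∈ Finset.range (a j), y i :=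
    (hx' (han hj)).trans_eq (hsum hj).symm
  have key (j : ℕ) (hj : j ≤ r) (k : ℕ) (hk : k ≤ a j) :
      S / n * k ≤ ∑ i ∈ Finset.range k, y i := by
    induction j with
    | zero => simp [Nat.le_zero.1 (ha0 ▸ hk)]
    | succ j ih =>
      rcases le_total k (a j) with hkj | hjk
      · exact ih (Nat.le_of_succ_le hj) hkj
      · rw [sum_range_eq_add_of_const hjk fun i hi hik => hy j hj i hi (hik.trans_le hk)]
        refine mul_le_add_mul_of_endpoints (Nat.cast_lt.2 (hmono j hj)) (Nat.cast_le.2 hjk)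
          (Nat.cast_le.2 hk) (hy' (Nat.le_of_succ_le hj)) ?_
        rw [← sum_range_eq_add_of_const (hmono j hj).le (hy j hj)]
        exact hy' hj
  intro k _ hk
  exact (by ring : (k / n : ℚ) * S = S / n * k).trans_le (key r le_rfl k (hk.trans_eq har.symm))
end
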